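/- arXiv:2204.11770 — 2 statements merged into one kernel-verified Lean document; each statement's English description precedes it below -/
import Mathlib

section
/- Let A be the companion matrix of f(x) = (x-1)^5 and B the companion matrix of g(x) = (x+1)³(x²+x+1), and set T = B·A⁻¹ in GL(5,ℚ). Then T² = I with T ≠ I, B has infinite order, and the hypergeometric group Γ(f,g) = ⟨A,B⟩ is the free product of the subgroup generated by T and the subgroup generated by B: the canonical group homomorphism from the abstract free product (ℤ/2ℤ) ∗ ℤ to GL(5,ℚ) sending the generator of ℤ/2ℤ to T and the generator of ℤ to B is injective with image Γ(f,g). -/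
open Polynomial Matrix

/-- The companion matrix of a monic degree-5 rational polynomial `p`:
the `5 × 5` matrix whose entries in position `(i+1, i)` equal `1` for
`i = 1, ..., 4`, whose last column is `(-p₀, -p₁, -p₂, -p₃, -p₄)ᵀ`
(where `pᵢ` is the coefficient of `xⁱ` in `p`), and whose remaining
entries are `0`. -/
def companionMatrix (p : ℚ[X]) : Matrix (Fin 5) (Fin 5) ℚ :=
  Matrix.of fun i j : Fin 5 =>
    if (j : ℕ) = 4 then -p.coeff i
    else if (i : ℕ) = (j : ℕ) + 1 then 1 else 0

open Pointwise in
/-- The ping-pong lemma for the free product of the two groups of a family indexed by `Bool`. -/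
theorem coprod_lift_injective_of_ping_pong_bool {H : Bool → Type} [∀ b, Group (H b)]
    [Infinite (H false)] {G α : Type*} [Group G] [MulAction G α] (F : ∀ b, H b →* G)
    (X : Bool → Set α) (hX : ∀ b, (X b).Nonempty) (hXY : Disjoint (X true) (X false))
    (hF : ∀ b, ∀ m : H b, m ≠ 1 → F b m • X (!b) ⊆ X b) :
    Function.Injective (Monoid.Coprod.lift (F true) (F false)) := by
  let toFamily : Monoid.Coprod (H true) (H false) →* Monoid.CoprodI H :=
    Monoid.Coprod.lift Monoid.CoprodI.of Monoid.CoprodI.of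
  let ofFamily : Monoid.CoprodI H →* Monoid.Coprod (H true) (H false) :=
    Monoid.CoprodI.lift fun
      | true => Monoid.Coprod.inl
      | false => Monoid.Coprod.inr
  have hinv : ofFamily.comp toFamily = MonoidHom.id _ := by
    ext x <;> simp [ofFamily, toFamily]
  have hfactor : (Monoid.CoprodI.lift F).comp toFamily =
      Monoid.Coprod.lift (F true) (F false) := by
    ext x <;> simp [toFamily]
  have hinj : Function.Injective (Monoid.CoprodI.lift F) := by
    refine Monoid.CoprodI.lift_injective_of_ping_pong F (Or.inr ⟨false, ?_⟩) X hX ?_ ?_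
    · exact (Cardinal.natCast_le_aleph0 (n := 3)).trans (Cardinal.aleph0_le_mk _)
    · rintro (_ | _) (_ | _) h
      exacts [absurd rfl h, hXY.symm, hXY, absurd rfl h]
    · rintro (_ | _) (_ | _) h
      exacts [absurd rfl h, hF false, hF true, absurd rfl h]
  rw [← hfactor]
  exact hinj.comp (Function.LeftInverse.injective (DFunLike.congr_fun hinv))

open Pointwise in
/-- The ping-pong lemma for the free product of a group with an infinite group. -/
theorem coprod_lift_injective_of_ping_pong {M N : Type} {G α : Type*} [hM : Group M]
    [hN : Group N] [hinf : Infinite N] [Group G] [MulAction G α] (f : M →* G) (g : N →* G)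
    (X Y : Set α) (hX : X.Nonempty) (hY : Y.Nonempty) (hXY : Disjoint X Y)
    (hf : ∀ m, m ≠ 1 → f m • Y ⊆ X) (hg : ∀ n, n ≠ 1 → g n • X ⊆ Y) :
    Function.Injective (Monoid.Coprod.lift f g) :=
  @coprod_lift_injective_of_ping_pong_bool (Bool.rec N M) (Bool.rec hN hM) hinf G α _ _
    (Bool.rec g f) (Bool.rec Y X) (Bool.rec hY hX) hXY (Bool.rec hg hf)

/-- The homomorphism from the cyclic group of order `n` determined by an element of exponent `n`. -/
def zmodPowHom {G : Type*} [Group G] (n : ℕ) (g : G) (hg : g ^ n = 1) :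
    Multiplicative (ZMod n) →* G :=
  AddMonoidHom.toMultiplicativeLeft
    (ZMod.lift n ⟨MonoidHom.toAdditiveRight (zpowersHom G g), by simpa [← ofMul_pow] using hg⟩)

lemma zmodPowHom_ofAdd_one {G : Type*} [Group G] (n : ℕ) (g : G) (hg : g ^ n = 1) :
    zmodPowHom n g hg (Multiplicative.ofAdd 1) = g := by
  have h := ZMod.lift_coe n ⟨MonoidHom.toAdditiveRight (zpowersHom G g),
    by simpa [← ofMul_pow] using hg⟩ 1
  rw [Int.cast_one] at h
  exact h.trans (zpow_one g)

/-- The explicit form of the reflection `T`. -/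
def reflectionMatrix : Matrix (Fin 5) (Fin 5) ℚ :=
  !![-1, 0, 0, 0, 0;
    1, 1, 0, 0, 0;
    -17, 0, 1, 0, 0;
    3, 0, 0, 1, 0;
    -9, 0, 0, 0, 1]

/-- The explicit form of `B`. -/
def rotationMatrix : Matrix (Fin 5) (Fin 5) ℚ :=
  !![0, 0, 0, 0, -1;
    1, 0, 0, 0, -4;
    0, 1, 0, 0, -7;
    0, 0, 1, 0, -7;
    0, 0, 0, 1, -4]

/-- An involution commuting with `T` and conjugating `B` to its inverse. -/
def mirrorMatrix : Matrix (Fin 5) (Fin 5) ℚ :=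
  !![1, 0, 0, 0, 0;
    4, 0, 0, 0, -1;
    7, 0, 0, -1, 0;
    7, 0, -1, 0, 0;
    4, -1, 0, 0, 0]

/-- The columns are the generators of the polyhedral ping-pong cone. -/
def coneGenerators : Matrix (Fin 5) (Fin 7) ℚ :=
  !![17, 17, 17, 17, 1, 1, 0;
    -110, -51, -78, 13, -4, 3, -1;
    120, 265, 160, 273, 6, 11, 3;
    -146, -1, -154, -41, -4, 1, -3;
    119, 178, 55, 146, 1, 8, 1]

/-- A linear functional, nonnegative on the cone, that changes sign under `-T`. -/
def height : Fin 5 → ℚ := ![-5, -3, -1, 1, 3]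

/-- Nonnegativity of a rational vector is decidable entrywise. -/
instance decidableNonneg {n : ℕ} (v : Fin n → ℚ) : Decidable (0 ≤ v) :=
  @Nat.decidableForallFin _ _ fun i => Rat.instDecidableLe 0 (v i)

/-- Membership in the closed polyhedral cone spanned by the columns of `coneGenerators`. -/
def InCone (x : Fin 5 → ℚ) : Prop :=
  ∃ c : Fin 7 → ℚ, 0 ≤ c ∧ coneGenerators *ᵥ c = x

lemma InCone.add {x y : Fin 5 → ℚ} (hx : InCone x) (hy : InCone y) : InCone (x + y) := by
  obtain ⟨c, hc, rfl⟩ := hx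
  obtain ⟨d, hd, rfl⟩ := hy
  exact ⟨c + d, add_nonneg hc hd, Matrix.mulVec_add _ _ _⟩

lemma InCone.nsmul {x : Fin 5 → ℚ} (hx : InCone x) (n : ℕ) : InCone (n • x) := by
  obtain ⟨c, hc, rfl⟩ := hx
  exact ⟨n • c, nsmul_nonneg hc n, Matrix.mulVec_smul _ _ _⟩

lemma InCone.dotProduct_nonneg {x a : Fin 5 → ℚ} (hx : InCone x)
    (ha : 0 ≤ a ᵥ* coneGenerators) : 0 ≤ a ⬝ᵥ x := by
  obtain ⟨c, hc, rfl⟩ := hx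
  rw [Matrix.dotProduct_mulVec]
  exact dotProduct_nonneg_of_nonneg ha hc

lemma InCone.height_nonneg {x : Fin 5 → ℚ} (hx : InCone x) : 0 ≤ height ⬝ᵥ x :=
  hx.dotProduct_nonneg (by decide +kernel)

/-- `M` maps the cone into itself. -/
def PreservesCone (M : Matrix (Fin 5) (Fin 5) ℚ) : Prop :=
  ∀ x, InCone x → InCone (M *ᵥ x)

lemma PreservesCone.of_factor {M : Matrix (Fin 5) (Fin 5) ℚ} {Λ : Matrix (Fin 7) (Fin 7) ℚ}
    (hΛ : ∀ i, 0 ≤ Λ.row i) (h : M * coneGenerators = coneGenerators * Λ) : PreservesCone M := by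
  rintro _ ⟨c, hc, rfl⟩
  exact ⟨Λ *ᵥ c, fun i => dotProduct_nonneg_of_nonneg (hΛ i) hc, by simp [h]⟩

/-- `M` maps the cone into itself without decreasing the height. -/
def ExpandsCone (M : Matrix (Fin 5) (Fin 5) ℚ) : Prop :=
  PreservesCone M ∧ ∀ x, InCone x → height ⬝ᵥ x ≤ height ⬝ᵥ (M *ᵥ x)

lemma ExpandsCone.of_factor {M : Matrix (Fin 5) (Fin 5) ℚ} {Λ : Matrix (Fin 7) (Fin 7) ℚ}
    (hΛ : ∀ i, 0 ≤ Λ.row i) (h : M * coneGenerators = coneGenerators * Λ)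
    (hheight : 0 ≤ (height ᵥ* M - height) ᵥ* coneGenerators) : ExpandsCone M := by
  refine ⟨.of_factor hΛ h, fun x hx => ?_⟩
  have := hx.dotProduct_nonneg hheight
  rwa [sub_dotProduct, ← Matrix.dotProduct_mulVec, sub_nonneg] at this

lemma ExpandsCone.add {M N : Matrix (Fin 5) (Fin 5) ℚ} (hM : ExpandsCone M)
    (hN : PreservesCone N) : ExpandsCone (M + N) := by
  refine ⟨fun x hx => ?_, fun x hx => ?_⟩ <;> rw [Matrix.add_mulVec]
  · exact (hM.1 x hx).add (hN x hx)
  · rw [dotProduct_add]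
    exact le_add_of_le_of_nonneg (hM.2 x hx) (hN x hx).height_nonneg

/-- The growth of `-T * (-B) ^ n` over the first period of the elliptic part of `-B`. -/
def stepMatrix : Matrix (Fin 5) (Fin 5) ℚ :=
  -reflectionMatrix * ((-rotationMatrix) ^ 6 - 1)

/-- The constant second difference of `-T * (-B) ^ n`. -/
def driftMatrix : Matrix (Fin 5) (Fin 5) ℚ :=
  stepMatrix * (-rotationMatrix - 1)

lemma expandsCone_one : ExpandsCone (-reflectionMatrix * (-rotationMatrix) ^ 1) :=
  .of_factor (Λ := !![1, 24/7, 0, 10/7, 0, 1/7, 0;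
    0, 0, 0, 1, 0, 0, 0;
    6, 235/49, 1, 263/49, 0, 6/49, 0;
    0, 1, 0, 0, 0, 0, 0;
    0, 1038/49, 38, 660/49, 1, 122/49, 1;
    0, 0, 0, 0, 0, 1, 0;
    0, 2452/49, 28, 1584/49, 0, 332/49, 1])
    (by decide +kernel) (by decide +kernel) (by decide +kernel)

lemma expandsCone_two : ExpandsCone (-reflectionMatrix * (-rotationMatrix) ^ 2) :=
  .of_factor (Λ := !![16, 647/35, 55/7, 16, 1/7, 29/35, 1/7;
    0, 38/35, 0, 0, 0, 1/35, 0;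
    67/7, 0, 281/49, 1/7, 6/49, 0, 6/49;
    7, 0, 0, 0, 0, 0, 0;
    478/7, 8321/35, 4309/49, 1551/7, 122/49, 347/35, 73/49;
    0, 4989/35, 55, 129, 1, 228/35, 1;
    2116/7, 5424/7, 15516/49, 4960/7, 332/49, 240/7, 283/49])
    (by decide +kernel) (by decide +kernel) (by decide +kernel)

lemma expandsCone_three : ExpandsCone (-reflectionMatrix * (-rotationMatrix) ^ 3) :=
  .of_factor (Λ := !![1653/35, 1706/35, 264/7, 1957/42, 29/35, 73/35, 23/35;
    302/35, 369/35, 0, 347/42, 1/35, 17/35, 2/35;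
    0, 0, 0, 0, 0, 0, 0;
    0, 0, 677/49, 0, 0, 0, 0;
    16419/35, 17163/35, 2176/7, 19441/42, 347/35, 684/35, 239/35;
    12471/35, 13047/35, 4122/49, 14933/42, 228/35, 551/35, 176/35;
    12672/7, 13296/7, 50028/49, 12588/7, 240/7, 552/7, 179/7])
    (by decide +kernel) (by decide +kernel) (by decide +kernel)

lemma expandsCone_four : ExpandsCone (-reflectionMatrix * (-rotationMatrix) ^ 4) :=
  .of_factor (Λ := !![3242/35, 3303/35, 603/7, 9164/119, 73/35, 131/35, 10/7;
    1163/35, 1217/35, 85/7, 5643/119, 17/35, 54/35, 3/7;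
    0, 0, 0, 7517/119, 0, 0, 0;
    0, 0, 307/7, 0, 0, 0, 0;
    29481/35, 30334/35, 3588/7, 0, 684/35, 1168/35, 89/7;
    24749/35, 25476/35, 0, 3142/7, 551/35, 1007/35, 75/7;
    24768/7, 25492/7, 12592/7, 234324/119, 552/7, 1004/7, 373/7])
    (by decide +kernel) (by decide +kernel) (by decide +kernel)

lemma expandsCone_five : ExpandsCone (-reflectionMatrix * (-rotationMatrix) ^ 5) :=
  .of_factor (Λ := !![5093/35, 1039/7, 5267/42, 4277/30, 131/35, 192/35, 81/35;
    2587/35, 528/7, 2467/42, 2203/30, 54/35, 108/35, 39/35;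
    0, 0, 0, 0, 0, 0, 0;
    0, 0, 0, 0, 0, 0, 0;
    46734/35, 9553/7, 47255/42, 38891/30, 1168/35, 1776/35, 723/35;
    40616/35, 8321/7, 41095/42, 34039/30, 1007/35, 1559/35, 632/35;
    40636/7, 41568/7, 34200/7, 5668, 1004/7, 1560/7, 631/7])
    (by decide +kernel) (by decide +kernel) (by decide +kernel)

lemma expandsCone_six : ExpandsCone (-reflectionMatrix * (-rotationMatrix) ^ 6) :=
  .of_factor (Λ := !![7009/35, 7164/35, 36779/210, 26419/119, 192/35, 36/5, 111/35;
    4356/35, 4441/35, 22261/210, 11117/119, 108/35, 24/5, 69/35;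
    0, 0, 0, 0, 0, 0, 0;
    0, 0, 0, 14923/119, 0, 0, 0;
    67327/35, 68647/35, 347477/210, 9484/7, 1776/35, 353/5, 1053/35;
    59263/35, 60583/35, 305533/210, 0, 1559/35, 312/5, 927/35;
    59280/7, 60528/7, 51000/7, 614928/119, 1560/7, 312, 929/7])
    (by decide +kernel) (by decide +kernel) (by decide +kernel)

lemma preservesCone_stepMatrix : PreservesCone stepMatrix :=
  .of_factor (Λ := !![7044/35, 7164/35, 6138/35, 6738/35, 192/35, 36/5, 111/35;
    4356/35, 4476/35, 3702/35, 4302/35, 108/35, 24/5, 69/35;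
    0, 0, 0, 0, 0, 0, 0;
    0, 0, 0, 0, 0, 0, 0;
    66732/35, 68052/35, 57774/35, 64374/35, 1776/35, 348/5, 1053/35;
    58668/35, 59988/35, 50466/35, 57066/35, 1524/35, 312/5, 927/35;
    59280/7, 60528/7, 51168/7, 57408/7, 1560/7, 312, 936/7])
    (by decide +kernel) (by decide +kernel)

lemma preservesCone_driftMatrix : PreservesCone driftMatrix :=
  .of_factor (Λ := !![384/7, 384/7, 348/7, 348/7, 12/7, 12/7, 6/7;
    384/7, 384/7, 348/7, 348/7, 12/7, 12/7, 6/7;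
    0, 0, 0, 0, 0, 0, 0;
    0, 0, 0, 0, 0, 0, 0;
    4224/7, 4224/7, 3828/7, 3828/7, 132/7, 132/7, 66/7;
    4224/7, 4224/7, 3828/7, 3828/7, 132/7, 132/7, 66/7;
    19968/7, 19968/7, 18096/7, 18096/7, 624/7, 624/7, 312/7])
    (by decide +kernel) (by decide +kernel)

lemma driftMatrix_mul : driftMatrix * -rotationMatrix = driftMatrix := by decide +kernel

lemma step_mul_pow (n : ℕ) :
    stepMatrix * (-rotationMatrix) ^ n = stepMatrix + n • driftMatrix := by
  induction n with
  | zero => simp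
  | succ n ih =>
    have : stepMatrix * -rotationMatrix = stepMatrix + driftMatrix := by
      rw [driftMatrix, mul_sub, mul_one]; abel
    rw [pow_succ, ← mul_assoc, ih, add_mul, this, smul_mul_assoc, driftMatrix_mul, succ_nsmul]
    abel

lemma preservesCone_step_mul_pow (n : ℕ) :
    PreservesCone (stepMatrix * (-rotationMatrix) ^ n) := by
  intro x hx
  rw [step_mul_pow, Matrix.add_mulVec, Matrix.smul_mulVec]
  exact (preservesCone_stepMatrix x hx).add ((preservesCone_driftMatrix x hx).nsmul n)

lemma expandsCone_pow : ∀ n : ℕ, ExpandsCone (-reflectionMatrix * (-rotationMatrix) ^ (n + 1))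
  | 0 => expandsCone_one
  | 1 => expandsCone_two
  | 2 => expandsCone_three
  | 3 => expandsCone_four
  | 4 => expandsCone_five
  | 5 => expandsCone_six
  | n + 6 => by
    have : -reflectionMatrix * (-rotationMatrix) ^ (n + 6 + 1) =
        -reflectionMatrix * (-rotationMatrix) ^ (n + 1) +
          stepMatrix * (-rotationMatrix) ^ (n + 1) := by
      rw [stepMatrix, show n + 6 + 1 = 6 + (n + 1) by ring, pow_add]
      noncomm_ring
    rw [this]
    exact (expandsCone_pow n).add (preservesCone_step_mul_pow _)

/-- The part of the cone of positive height together with its negative. -/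
def pingPongSet : Set (Fin 5 → ℚ) :=
  {x | (InCone x ∧ 0 < height ⬝ᵥ x) ∨ (InCone (-x) ∧ 0 < height ⬝ᵥ (-x))}

lemma neg_mem_pingPongSet {x : Fin 5 → ℚ} : -x ∈ pingPongSet ↔ x ∈ pingPongSet := by
  simp only [pingPongSet, Set.mem_ofPred_eq, neg_neg, or_comm]

lemma ExpandsCone.mem_pingPongSet {M : Matrix (Fin 5) (Fin 5) ℚ} (hM : ExpandsCone M)
    {x : Fin 5 → ℚ} (hx : x ∈ pingPongSet) : M *ᵥ x ∈ pingPongSet := by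
  rcases hx with ⟨hx, h⟩ | ⟨hx, h⟩
  · exact Or.inl ⟨hM.1 x hx, h.trans_le (hM.2 x hx)⟩
  · rw [← neg_mem_pingPongSet, ← Matrix.mulVec_neg]
    exact Or.inl ⟨hM.1 _ hx, h.trans_le (hM.2 _ hx)⟩

lemma pow_mulVec_mem_pingPongSet {n : ℕ} (hn : n ≠ 0) {x : Fin 5 → ℚ} (hx : x ∈ pingPongSet) :
    (reflectionMatrix * rotationMatrix ^ n) *ᵥ x ∈ pingPongSet := by
  obtain ⟨k, rfl⟩ := Nat.exists_eq_succ_of_ne_zero hn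
  have h := (expandsCone_pow k).mem_pingPongSet hx
  rcases Nat.even_or_odd (k + 1) with hk | hk
  · rwa [hk.neg_pow, neg_mul, Matrix.neg_mulVec, neg_mem_pingPongSet] at h
  · rwa [hk.neg_pow, neg_mul_neg] at h

lemma mirror_mulVec_mem_pingPongSet {x : Fin 5 → ℚ} (hx : x ∈ pingPongSet) :
    mirrorMatrix *ᵥ x ∈ pingPongSet := by
  refine ExpandsCone.mem_pingPongSet (.of_factor
    (Λ := (c[0, 1] * c[2, 3] * c[4, 5] : Equiv.Perm (Fin 7)).permMatrix ℚ)
    (by decide +kernel) (by decide +kernel) (by decide +kernel)) hx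

lemma height_reflection (x : Fin 5 → ℚ) :
    height ⬝ᵥ (reflectionMatrix *ᵥ x) = height ⬝ᵥ x := by
  rw [Matrix.dotProduct_mulVec]
  congr 1
  decide +kernel

/-- The cone of positive height is disjoint from its image under `T`,
because the first coordinate is nonnegative on the cone and changes sign under `T`. -/
lemma not_inCone_reflection {x : Fin 5 → ℚ} (hx : InCone x) (h : 0 < height ⬝ᵥ x) :
    ¬ InCone (reflectionMatrix *ᵥ x) := by
  intro hTx
  have hfirst := hTx.dotProduct_nonneg (a := Pi.single 0 1) (by decide +kernel)
  have hle := hx.dotProduct_nonneg (a := 336 • Pi.single 0 1 - 17 • height) (by decide +kernel)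
  simp [Matrix.mulVec, reflectionMatrix, dotProduct, Fin.sum_univ_succ] at *
  linarith

lemma disjoint_pingPongSet :
    Disjoint pingPongSet {x | reflectionMatrix *ᵥ x ∈ pingPongSet} := by
  rw [Set.disjoint_left]
  rintro x (⟨hx, h⟩ | ⟨hx, h⟩) (⟨hT, h'⟩ | ⟨hT, h'⟩)
  · exact not_inCone_reflection hx h hT
  · rw [dotProduct_neg, height_reflection] at h'
    linarith
  · rw [height_reflection] at h'
    rw [dotProduct_neg] at h
    linarith
  · rw [← Matrix.mulVec_neg] at hT
    exact not_inCone_reflection hx h hT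

/-- `mirrorMatrix` as an element of the general linear group. -/
def mirror : GL (Fin 5) ℚ :=
  ⟨mirrorMatrix, mirrorMatrix, by decide +kernel, by decide +kernel⟩

lemma pow_smul_mem_pingPongSet {B : GL (Fin 5) ℚ}
    (hB : (B : Matrix (Fin 5) (Fin 5) ℚ) = rotationMatrix) {n : ℕ} (hn : n ≠ 0) {x : Fin 5 → ℚ}
    (hx : x ∈ pingPongSet) : reflectionMatrix *ᵥ (B ^ n • x) ∈ pingPongSet := by
  rw [Units.smul_def, Matrix.smul_eq_mulVec, Units.val_pow_eq_pow_val, hB, Matrix.mulVec_mulVec]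
  exact pow_mulVec_mem_pingPongSet hn hx

lemma zpow_smul_mem_pingPongSet {B : GL (Fin 5) ℚ}
    (hB : (B : Matrix (Fin 5) (Fin 5) ℚ) = rotationMatrix) {n : ℤ} (hn : n ≠ 0) {x : Fin 5 → ℚ}
    (hx : x ∈ pingPongSet) : reflectionMatrix *ᵥ (B ^ n • x) ∈ pingPongSet := by
  obtain ⟨k, rfl | rfl⟩ := n.eq_nat_or_neg
  · rw [zpow_natCast]
    exact pow_smul_mem_pingPongSet hB (by simpa using hn) hx
  · have hconj : B⁻¹ = mirror * B * mirror⁻¹ := by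
      refine inv_eq_of_mul_eq_one_right (Units.ext ?_)
      change B.val * (mirrorMatrix * B.val * mirrorMatrix) = 1
      rw [hB]
      decide +kernel
    have hcomm : reflectionMatrix * mirrorMatrix = mirrorMatrix * reflectionMatrix := by
      decide +kernel
    have hmem := mirror_mulVec_mem_pingPongSet (pow_smul_mem_pingPongSet hB (n := k)
      (by simpa using hn) (mirror_mulVec_mem_pingPongSet hx))
    rw [Matrix.mulVec_mulVec, ← hcomm, ← Matrix.mulVec_mulVec] at hmem
    rw [_root_.zpow_neg, zpow_natCast, ← inv_pow, hconj, conj_pow, mul_smul, mul_smul]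
    exact hmem

lemma companionMatrix_X_sub_one_pow :
    companionMatrix ((X - 1) ^ 5) =
      !![0, 0, 0, 0, 1;
        1, 0, 0, 0, -5;
        0, 1, 0, 0, 10;
        0, 0, 1, 0, -10;
        0, 0, 0, 1, 5] := by
  have h : ((X - 1) ^ 5 : ℚ[X]) =
      X ^ 5 + C (-5) * X ^ 4 + C 10 * X ^ 3 + C (-10) * X ^ 2 + C 5 * X + C (-1) := by
    simp only [map_neg, map_ofNat, map_one]
    ring
  ext i j
  rw [companionMatrix, h]
  fin_cases i <;> fin_cases j <;> simp [coeff_X, coeff_one]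

lemma companionMatrix_rotation :
    companionMatrix ((X + 1) ^ 3 * (X ^ 2 + X + 1)) = rotationMatrix := by
  have h : ((X + 1) ^ 3 * (X ^ 2 + X + 1) : ℚ[X]) =
      X ^ 5 + C 4 * X ^ 4 + C 7 * X ^ 3 + C 7 * X ^ 2 + C 4 * X + C 1 := by
    simp only [map_ofNat, map_one]
    ring
  ext i j
  rw [companionMatrix, rotationMatrix, h]
  fin_cases i <;> fin_cases j <;> simp [coeff_X, coeff_one]

lemma val_eq_reflectionMatrix {A B T : GL (Fin 5) ℚ}
    (hA : (↑A : Matrix (Fin 5) (Fin 5) ℚ) = companionMatrix ((X - 1) ^ 5))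
    (hB : (↑B : Matrix (Fin 5) (Fin 5) ℚ) = rotationMatrix)
    (hT : T = B * A⁻¹) : (T : Matrix (Fin 5) (Fin 5) ℚ) = reflectionMatrix := by
  rw [hT, Units.val_mul, Units.mul_inv_eq_iff_eq_mul, hA, hB, companionMatrix_X_sub_one_pow]
  decide +kernel

lemma coprod_lift_injective {B T : GL (Fin 5) ℚ}
    (hB : (B : Matrix (Fin 5) (Fin 5) ℚ) = rotationMatrix)
    (hT : (T : Matrix (Fin 5) (Fin 5) ℚ) = reflectionMatrix) (hT2 : T ^ 2 = 1) :
    Function.Injective (Monoid.Coprod.lift (zmodPowHom 2 T hT2) (zpowersHom _ B)) := by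
  have hsmul (x : Fin 5 → ℚ) : T • x = reflectionMatrix *ᵥ x := by
    rw [Units.smul_def, Matrix.smul_eq_mulVec, hT]
  have hne : pingPongSet.Nonempty :=
    ⟨![17, -110, 120, -146, 119],
      Or.inl ⟨⟨Pi.single 0 1, by decide +kernel, by decide +kernel⟩, by decide +kernel⟩⟩
  refine coprod_lift_injective_of_ping_pong _ _ pingPongSet
    {x | reflectionMatrix *ᵥ x ∈ pingPongSet} hne ?_ disjoint_pingPongSet ?_ ?_
  · obtain ⟨x, hx⟩ := hne
    refine ⟨T • x, ?_⟩
    rwa [Set.mem_ofPred_eq, ← hsmul, smul_smul, ← sq, hT2, one_smul]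
  · rintro m hm _ ⟨x, hx, rfl⟩
    have hm' : m = Multiplicative.ofAdd 1 := by
      revert m
      decide
    simp only [hm', zmodPowHom_ofAdd_one, hsmul]
    exact hx
  · rintro n hn _ ⟨x, hx, rfl⟩
    exact zpow_smul_mem_pingPongSet hB hn hx

/-- `Γ(f,g) = ⟨T⟩ ∗ ⟨B⟩` for `f = ((X - 1) ^ 5)`, `g = ((X + 1) ^ 3 * (X ^ 2 + X + 1))`. -/
theorem hypergeometric_free_product_case1 (A B T : GL (Fin 5) ℚ)
    (hA : (↑A : Matrix (Fin 5) (Fin 5) ℚ) = companionMatrix ((X - 1) ^ 5))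
    (hB : (↑B : Matrix (Fin 5) (Fin 5) ℚ) = companionMatrix ((X + 1) ^ 3 * (X ^ 2 + X + 1)))
    (hT : T = B * A⁻¹) :
    T ^ 2 = 1 ∧ T ≠ 1 ∧ ¬ IsOfFinOrder B ∧
    ∃ φ : Monoid.Coprod (Multiplicative (ZMod 2)) (Multiplicative ℤ) →* GL (Fin 5) ℚ,
      φ (Monoid.Coprod.inl (Multiplicative.ofAdd (1 : ZMod 2))) = T ∧
      φ (Monoid.Coprod.inr (Multiplicative.ofAdd (1 : ℤ))) = B ∧
      Function.Injective φ ∧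
      φ.range = Subgroup.closure {A, B} := by
  rw [companionMatrix_rotation] at hB
  have hTval := val_eq_reflectionMatrix hA hB hT
  have hT2 : T ^ 2 = 1 := Units.ext <| by
    rw [Units.val_pow_eq_pow_val, hTval]
    decide +kernel
  have hinj := coprod_lift_injective hB hTval hT2
  refine ⟨hT2, ?_, ?_, Monoid.Coprod.lift (zmodPowHom 2 T hT2) (zpowersHom _ B), ?_, ?_, hinj, ?_⟩
  · rintro rfl
    rw [Units.val_one] at hTval
    revert hTval
    decide +kernel
  · have hB_inj : Function.Injective (zpowersHom _ B) := by
      rw [← Monoid.Coprod.lift_comp_inr (zmodPowHom 2 T hT2) (zpowersHom _ B)]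
      exact hinj.comp Monoid.Coprod.inr_injective
    rw [← injective_zpow_iff_not_isOfFinOrder]
    exact hB_inj
  · rw [Monoid.Coprod.lift_apply_inl, zmodPowHom_ofAdd_one]
  · simp
  · have hTrange : (zmodPowHom 2 T hT2).range = Subgroup.zpowers T := by
      refine le_antisymm ?_ ?_
      · rintro _ ⟨m, rfl⟩
        have hm : m = 1 ∨ m = Multiplicative.ofAdd 1 := by
          revert m
          decide
        rcases hm with rfl | rfl
        · rw [map_one]
          exact one_mem _
        · rw [zmodPowHom_ofAdd_one]
          exact Subgroup.mem_zpowers T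
      · rw [Subgroup.zpowers_le]
        exact ⟨_, zmodPowHom_ofAdd_one 2 T hT2⟩
    have hBrange : (zpowersHom _ B).range = Subgroup.zpowers B := rfl
    rw [Monoid.Coprod.range_lift, hTrange, hBrange, Subgroup.zpowers_eq_closure,
      Subgroup.zpowers_eq_closure, ← Subgroup.closure_union]
    refine le_antisymm ?_ ?_ <;> rw [Subgroup.closure_le]
    · rintro _ (rfl | rfl)
      · rw [hT]
        exact mul_mem (Subgroup.subset_closure (by simp))
          (inv_mem (Subgroup.subset_closure (by simp)))
      · exact Subgroup.subset_closure (by simp)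
    · rintro _ (hx | rfl)
      · rw [hx, show A = T⁻¹ * B by rw [hT]; group]
        exact mul_mem (inv_mem (Subgroup.subset_closure (by simp)))
          (Subgroup.subset_closure (by simp))
      · exact Subgroup.subset_closure (by simp)
end

section
/- Let A be the companion matrix of f(x) = (x-1)^5 and B the companion matrix of g(x) = (x+1)(x⁴+1), and set T = B·A⁻¹ in GL(5,ℚ). Then T² = I with T ≠ I, B has order 8 and no power of B equals −I, and the hypergeometric group Γ(f,g) = ⟨A,B⟩ is the free product of the subgroup generated by T and the subgroup generated by B: the canonical group homomorphism from the abstract free product (ℤ/2ℤ) ∗ (ℤ/8ℤ) to GL(5,ℚ) sending the generator of ℤ/2ℤ to T and the generator of ℤ/8ℤ to B is injective with image Γ(f,g). -/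
open Polynomial Matrix

namespace Monoid.Coprod

variable {G H K : Type*} [Group G] [Group H] [Group K]

/-- Products `g₁h₁g₂h₂⋯gₙhₙ` with all `gᵢ` and `hᵢ` nontrivial. -/
inductive IsAlternating : G ∗ H → Prop
  | one : IsAlternating 1
  | cons {g : G} {h : H} {p : G ∗ H} (hg : g ≠ 1) (hh : h ≠ 1) (hp : IsAlternating p) :
      IsAlternating (inl g * inr h * p)

theorem exists_eq_inr_mul_mul_inl (hG : ∀ a b : G, a ≠ 1 → b ≠ 1 → a * b = 1) (x : G ∗ H) :
    ∃ (h : H) (p : G ∗ H) (g : G), IsAlternating p ∧ x = inr h * p * inl g := by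
  induction x using induction_on' with
  | one => exact ⟨1, 1, 1, .one, by simp⟩
  | inr_mul h' x ih =>
    obtain ⟨h, p, g, hp, rfl⟩ := ih
    exact ⟨h' * h, p, g, hp, by simp [mul_assoc]⟩
  | inl_mul a x ih =>
    obtain ⟨h, p, g, hp, rfl⟩ := ih
    by_cases ha : a = 1
    · exact ⟨h, p, g, hp, by simp [ha]⟩
    by_cases hh : h = 1
    · subst hh
      cases hp with
      | one => exact ⟨1, 1, a * g, .one, by simp⟩
      | @cons b k q hb hk hq =>
        refine ⟨k, q, g, hq, ?_⟩
        have hab : (inl a * inl b : G ∗ H) = 1 := by rw [← map_mul, hG a b ha hb, map_one]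
        simp only [map_one, one_mul, ← mul_assoc, hab]
    · exact ⟨1, inl a * inr h * p, g, .cons ha hh hp, by simp [mul_assoc]⟩

theorem IsAlternating.map_mem {f : G ∗ H →* K} {S : Submonoid K}
    (hS : ∀ g : G, g ≠ 1 → ∀ h : H, h ≠ 1 → f (inl g * inr h) ∈ S)
    {p : G ∗ H} (hp : IsAlternating p) : f p ∈ S := by
  induction hp with
  | one => simp
  | cons hg hh _ ih => rw [map_mul]; exact S.mul_mem (hS _ hg _ hh) ih

/-- A semigroup version of the ping-pong lemma: it suffices that a submonoid of the target contains
the images of all `gh` with `g` and `h` nontrivial, but of no `hg` apart from `1`. -/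
theorem injective_of_submonoid (f : G ∗ H →* K) (S : Submonoid K)
    (hG : ∀ a b : G, a ≠ 1 → b ≠ 1 → a * b = 1)
    (hS : ∀ g : G, g ≠ 1 → ∀ h : H, h ≠ 1 → f (inl g * inr h) ∈ S)
    (hS' : ∀ (h : H) (g : G), f (inr h * inl g) ∈ S → h = 1 ∧ g = 1) :
    Function.Injective f := by
  rw [injective_iff_map_eq_one]
  intro x hx
  obtain ⟨h, p, g, hp, rfl⟩ := exists_eq_inr_mul_mul_inl hG x
  have hfp : f p = f (inr h⁻¹ * inl g⁻¹) := by
    simp only [map_mul, map_inv] at hx ⊢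
    rw [eq_inv_mul_iff_mul_eq, eq_inv_iff_mul_eq_one, hx]
  obtain ⟨hh, hg⟩ := hS' _ _ (hfp ▸ hp.map_mem hS)
  rw [inv_eq_one] at hh hg
  subst hh hg
  cases hp with
  | one => simp
  | @cons a k q ha hk hq =>
    have hfq : f q = f (inr k⁻¹ * inl a⁻¹) := by
      simp only [map_mul, map_inv, map_one, one_mul, mul_one] at hx ⊢
      rw [eq_inv_of_mul_eq_one_right hx, _root_.mul_inv_rev]
    exact absurd (inv_eq_one.mp (hS' _ _ (hfq ▸ hq.map_mem hS)).1) hk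

end Monoid.Coprod

/-- The homomorphism from `ℤ/n` sending the generator to `x`, where `x ^ n = 1`. -/
def zmodPowersHom {G : Type*} [Group G] (n : ℕ) (x : G) (hx : x ^ n = 1) :
    Multiplicative (ZMod n) →* G :=
  AddMonoidHom.toMultiplicativeLeft <| ZMod.lift n
    ⟨AddMonoidHom.toMultiplicativeLeft.symm (zpowersHom G x), by
      simpa [zpowersHom_apply] using congrArg Additive.ofMul hx⟩

theorem zmodPowersHom_ofAdd_natCast {G : Type*} [Group G] (n : ℕ) (x : G) (hx : x ^ n = 1)
    (k : ℕ) : zmodPowersHom n x hx (Multiplicative.ofAdd (k : ZMod n)) = x ^ k := by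
  have := ZMod.lift_coe n (A := Additive G)
    ⟨AddMonoidHom.toMultiplicativeLeft.symm (zpowersHom G x), by
      simpa [zpowersHom_apply] using congrArg Additive.ofMul hx⟩ (k : ℤ)
  rw [Int.cast_natCast] at this
  simp [zmodPowersHom, this, zpowersHom_apply]

theorem exists_ofAdd_natCast_eq {n : ℕ} [NeZero n] (x : Multiplicative (ZMod n)) :
    ∃ k : Fin n, Multiplicative.ofAdd ((k : ℕ) : ZMod n) = x :=
  ⟨⟨x.toAdd.val, ZMod.val_lt _⟩, by simp⟩

namespace HypergeometricPingPong

/-- The reflection `T` over `ℤ`. -/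
def reflection : Matrix (Fin 5) (Fin 5) ℤ :=
  !![-1, 0, 0, 0, 0; 4, 1, 0, 0, 0; -10, 0, 1, 0, 0; 10, 0, 0, 1, 0; -6, 0, 0, 0, 1]

/-- The powers of the companion matrix of `(X + 1) * (X ^ 4 + 1)` over `ℤ`. -/
def companionPow : Fin 8 → Matrix (Fin 5) (Fin 5) ℤ := ![
  !![1, 0, 0, 0, 0; 0, 1, 0, 0, 0; 0, 0, 1, 0, 0; 0, 0, 0, 1, 0; 0, 0, 0, 0, 1],
  !![0, 0, 0, 0, -1; 1, 0, 0, 0, -1; 0, 1, 0, 0, 0; 0, 0, 1, 0, 0; 0, 0, 0, 1, -1],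
  !![0, 0, 0, -1, 1; 0, 0, 0, -1, 0; 1, 0, 0, 0, -1; 0, 1, 0, 0, 0; 0, 0, 1, -1, 1],
  !![0, 0, -1, 1, -1; 0, 0, -1, 0, 0; 0, 0, 0, -1, 0; 1, 0, 0, 0, -1; 0, 1, -1, 1, -1],
  !![0, -1, 1, -1, 1; 0, -1, 0, 0, 0; 0, 0, -1, 0, 0; 0, 0, 0, -1, 0; 1, -1, 1, -1, 0],
  !![-1, 1, -1, 1, 0; -1, 0, 0, 0, 1; 0, -1, 0, 0, 0; 0, 0, -1, 0, 0; -1, 1, -1, 0, 0],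
  !![1, -1, 1, 0, 0; 0, 0, 0, 1, 0; -1, 0, 0, 0, 1; 0, -1, 0, 0, 0; 1, -1, 0, 0, 0],
  !![-1, 1, 0, 0, 0; 0, 0, 1, 0, 0; 0, 0, 0, 1, 0; -1, 0, 0, 0, 1; -1, 0, 0, 0, 0]]

/-- Generators of a cone in `ℤ⁵` that `reflection * companionPow i` maps to plus or minus itself for
all `i ≠ 0`. -/
def rays : Fin 28 → Fin 5 → ℤ :=
  ![ ![2, -12, 23, -20, 7],
    ![5, -21, 35, -27, 8],
    ![3, -14, 24, -18, 5],
    ![1, -4, 6, -4, 1],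
    ![2, -5, 20, -23, 14],
    ![5, -3, 27, -35, 26],
    ![3, -2, 18, -24, 17],
    ![1, 0, 4, -6, 5],
    ![35, -167, 353, -329, 140],
    ![23, -110, 232, -216, 91],
    ![41, -188, 424, -408, 187],
    ![47, -212, 488, -472, 221],
    ![88, -379, 915, -901, 437],
    ![59, -254, 614, -604, 293],
    ![88, -349, 901, -915, 467],
    ![59, -234, 604, -614, 313],
    ![47, -174, 472, -488, 259],
    ![41, -146, 408, -424, 229],
    ![35, -105, 329, -353, 202],
    ![23, -68, 216, -232, 133],
    ![140, -665, 1233, -1047, 371],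
    ![91, -432, 800, -678, 239],
    ![187, -894, 1682, -1446, 527],
    ![221, -1058, 1998, -1722, 633],
    ![221, -412, 1722, -1998, 1279],
    ![187, -340, 1446, -1682, 1081],
    ![140, -231, 1047, -1233, 805],
    ![91, -148, 678, -800, 523]]

/-- The entry `(d, [(c₁, k₁), …])` at `(i, j)` certifies that
`d • (reflection * companionPow (i + 1)) *ᵥ rays j` equals `± ∑ cₗ • rays kₗ`. -/
def cert : Fin 7 → Fin 28 → ℕ × List (ℕ × Fin 28) :=
  ![
    ![ (1, [(1, 0), (1, 1)]), (1, [(1, 1), (1, 2)]), (1, [(1, 2), (2, 3)]), (1, [(1, 3)]),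
      (1, [(5, 0), (2, 3), (2, 7)]), (2, [(3, 0), (3, 2), (1, 4), (1, 8)]),
      (1, [(6, 0), (2, 3), (1, 6)]), (1, [(2, 0), (1, 7)]), (1, [(1, 20)]), (1, [(1, 21)]),
      (1, [(1, 22)]), (1, [(1, 23)]), (7, [(92, 0), (9, 1), (112, 3), (7, 10), (13, 22)]),
      (1, [(24, 0), (15, 3), (9, 7), (1, 23)]), (2, [(24, 0), (2, 1), (2, 11), (3, 22), (1, 23)]),
      (1, [(34, 0), (10, 3), (14, 7), (1, 23)]),
      (27, [(286, 0), (14, 1), (538, 3), (99, 9), (16, 23)]),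
      (27, [(386, 0), (34, 1), (782, 3), (117, 9), (8, 23)]),
      (4, [(100, 0), (43, 1), (42, 3), (3, 8), (6, 10)]),
      (5, [(50, 0), (13, 2), (112, 3), (18, 9)]),
      (1, [(28, 0), (37, 1), (12, 2), (1, 6), (1, 21)]),
      (1, [(29, 0), (31, 1), (7, 2), (1, 4), (1, 6)]), (1, [(71, 0), (73, 1), (2, 2), (7, 4)]),
      (1, [(98, 0), (78, 1), (7, 2), (8, 3), (18, 7)]),
      (1, [(436, 0), (172, 3), (176, 7), (1, 13)]), (1, [(374, 0), (146, 3), (146, 7), (1, 17)]),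
      (1, [(280, 0), (105, 3), (105, 7), (1, 18)]),
      (4, [(80, 0), (3, 1), (122, 2), (46, 3), (43, 8)])],
    ![ (7, [(5, 0), (4, 3), (2, 8), (1, 9), (2, 10)]), (1, [(1, 8)]), (1, [(1, 9)]),
      (1, [(2, 0), (1, 7)]), (4, [(7, 0), (1, 1), (3, 4), (3, 10)]),
      (9, [(15, 0), (2, 2), (9, 4), (1, 6), (12, 10)]), (1, [(1, 10)]), (8, [(1, 10), (1, 11)]),
      (4, [(32, 0), (16, 3), (28, 8), (5, 10), (13, 11)]),
      (1, [(10, 0), (2, 1), (2, 3), (2, 8), (5, 10)]),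
      (3, [(96, 0), (18, 1), (4, 2), (5, 6), (36, 10)]),
      (4, [(328, 0), (44, 3), (132, 7), (37, 10), (9, 11)]),
      (11, [(725, 0), (486, 3), (225, 4), (103, 9), (243, 10)]),
      (1, [(46, 0), (26, 3), (18, 4), (6, 8), (13, 10)]),
      (11, [(747, 0), (486, 3), (247, 4), (81, 9), (265, 10)]),
      (8, [(816, 0), (64, 3), (344, 7), (91, 10), (35, 11)]),
      (2, [(116, 0), (36, 3), (16, 6), (23, 10), (5, 11)]),
      (2, [(108, 0), (28, 3), (16, 6), (19, 10), (5, 11)]),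
      (11, [(325, 0), (164, 3), (157, 4), (31, 9), (104, 10)]),
      (8, [(240, 0), (40, 3), (40, 6), (43, 10), (11, 11)]),
      (7, [(180, 0), (158, 3), (149, 8), (29, 9), (86, 10)]),
      (2, [(24, 0), (16, 3), (36, 8), (9, 10), (3, 11)]),
      (7, [(306, 0), (284, 3), (156, 8), (71, 9), (142, 10)]),
      (11, [(734, 0), (190, 1), (314, 8), (5, 9), (302, 10)]),
      (2, [(128, 0), (80, 9), (29, 10), (57, 11), (10, 15)]),
      (8, [(1023, 0), (145, 1), (503, 4), (447, 10)]),
      (2, [(354, 0), (136, 7), (55, 10), (12, 11), (7, 15)]),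
      (4, [(219, 0), (29, 1), (115, 4), (4, 9), (107, 10)])],
    ![ (8, [(16, 0), (8, 4), (7, 11), (1, 19)]), (7, [(16, 0), (9, 11), (1, 18)]), (1, [(1, 11)]),
      (8, [(1, 10), (1, 11)]), (3, [(3, 0), (6, 4), (2, 11), (1, 13)]), (1, [(1, 12)]),
      (1, [(1, 13)]), (8, [(16, 0), (1, 16), (1, 17)]),
      (2, [(66, 0), (16, 3), (13, 11), (8, 13), (7, 15)]),
      (8, [(400, 0), (40, 3), (1, 10), (33, 11), (40, 16)]),
      (4, [(94, 0), (12, 4), (34, 10), (37, 13), (7, 17)]),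
      (8, [(352, 0), (24, 2), (448, 4), (163, 11), (5, 19)]),
      (13, [(258, 0), (150, 4), (228, 10), (41, 12), (263, 13)]),
      (13, [(167, 0), (85, 4), (150, 10), (41, 12), (159, 13)]),
      (3, [(243, 0), (42, 3), (333, 4), (104, 11), (13, 13)]),
      (2, [(128, 0), (24, 3), (18, 11), (11, 12), (11, 14)]),
      (8, [(912, 0), (40, 3), (17, 10), (49, 11), (104, 16)]),
      (8, [(752, 0), (24, 3), (15, 10), (47, 11), (88, 16)]),
      (2, [(16, 0), (8, 10), (15, 12), (1, 14)]),
      (4, [(40, 0), (3, 10), (15, 11), (16, 13), (8, 15)]),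
      (8, [(840, 0), (296, 4), (369, 11), (8, 17), (55, 19)]),
      (3, [(162, 0), (48, 3), (138, 4), (82, 11), (11, 13)]),
      (1, [(128, 0), (36, 3), (118, 4), (59, 11), (6, 13)]),
      (8, [(1328, 0), (32, 2), (768, 4), (613, 11), (75, 19)]),
      (2, [(138, 0), (5, 8), (29, 11), (78, 12), (15, 14)]),
      (3, [(192, 0), (426, 4), (142, 11), (6, 12), (71, 13)]),
      (3, [(111, 0), (237, 4), (82, 11), (30, 12), (35, 13)]),
      (1, [(12, 0), (3, 10), (2, 11), (19, 12), (1, 14)])],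
    ![ (8, [(24, 0), (48, 4), (7, 11), (1, 19)]),
      (11, [(84, 0), (12, 4), (2, 12), (6, 14), (3, 18)]), (2, [(7, 0), (2, 3), (9, 4), (1, 12)]),
      (8, [(16, 0), (1, 16), (1, 17)]), (8, [(16, 0), (56, 4), (7, 11), (1, 19)]),
      (8, [(24, 0), (8, 3), (104, 4), (1, 10), (9, 11)]), (2, [(9, 0), (7, 4), (2, 7), (1, 14)]),
      (8, [(16, 4), (1, 10), (1, 11)]), (2, [(150, 0), (12, 4), (1, 10), (19, 15), (12, 17)]),
      (4, [(40, 0), (190, 4), (19, 10), (22, 13), (1, 15)]),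
      (11, [(675, 0), (175, 4), (31, 12), (93, 14), (19, 18)]),
      (1, [(11, 0), (95, 4), (8, 10), (5, 12), (7, 13)]),
      (1, [(192, 0), (16, 4), (7, 14), (16, 15), (16, 17)]),
      (9, [(456, 0), (78, 3), (1674, 4), (203, 11), (34, 13)]),
      (1, [(16, 0), (192, 4), (16, 10), (7, 12), (16, 13)]),
      (9, [(1674, 0), (456, 4), (78, 7), (34, 15), (203, 16)]),
      (1, [(95, 0), (11, 4), (5, 14), (7, 15), (8, 17)]),
      (11, [(175, 0), (675, 4), (19, 8), (93, 12), (31, 14)]),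
      (2, [(12, 0), (150, 4), (12, 10), (19, 13), (1, 17)]),
      (4, [(190, 0), (40, 4), (1, 13), (22, 15), (19, 17)]),
      (1, [(287, 0), (75, 4), (9, 10), (21, 15), (24, 17)]),
      (2, [(90, 0), (300, 4), (5, 9), (24, 10), (41, 13)]),
      (1, [(205, 0), (149, 4), (19, 6), (28, 12), (15, 14)]),
      (2, [(1232, 0), (336, 4), (4, 6), (21, 9), (153, 16)]),
      (2, [(158, 0), (916, 4), (76, 10), (81, 13), (19, 17)]),
      (1, [(149, 0), (19, 2), (205, 4), (15, 12), (28, 14)]),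
      (1, [(75, 0), (287, 4), (24, 10), (21, 13), (9, 17)]),
      (2, [(300, 0), (90, 4), (41, 15), (24, 17), (5, 19)])],
    ![ (3, [(6, 0), (3, 4), (1, 15), (2, 16)]), (1, [(1, 14)]), (1, [(1, 15)]),
      (8, [(16, 4), (1, 10), (1, 11)]), (8, [(8, 0), (16, 4), (1, 9), (7, 16)]),
      (9, [(9, 0), (15, 4), (6, 7), (1, 15), (11, 16)]), (1, [(1, 16)]), (8, [(1, 16), (1, 17)]),
      (1, [(37, 0), (35, 4), (2, 10), (14, 16)]),
      (2, [(12, 4), (1, 12), (9, 14), (2, 16), (4, 17)]),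
      (8, [(752, 4), (24, 7), (88, 11), (47, 16), (15, 17)]),
      (8, [(912, 4), (40, 7), (104, 11), (49, 16), (17, 17)]),
      (3, [(333, 0), (243, 4), (42, 7), (13, 15), (104, 16)]),
      (2, [(128, 4), (24, 7), (11, 12), (11, 14), (18, 16)]),
      (13, [(150, 0), (258, 4), (41, 14), (263, 15), (228, 17)]),
      (13, [(85, 0), (167, 4), (41, 14), (159, 15), (150, 17)]),
      (8, [(448, 0), (352, 4), (24, 6), (5, 9), (163, 16)]),
      (4, [(12, 0), (94, 4), (7, 10), (37, 15), (34, 17)]),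
      (2, [(66, 4), (16, 7), (7, 13), (8, 15), (13, 16)]),
      (8, [(400, 4), (40, 7), (40, 11), (33, 16), (1, 17)]),
      (3, [(237, 0), (111, 4), (30, 14), (35, 15), (82, 16)]),
      (1, [(12, 4), (1, 12), (19, 14), (2, 16), (3, 17)]),
      (3, [(426, 0), (192, 4), (6, 14), (71, 15), (142, 16)]),
      (2, [(138, 4), (15, 12), (78, 14), (29, 16), (5, 18)]),
      (8, [(768, 0), (1328, 4), (32, 6), (75, 9), (613, 16)]),
      (1, [(118, 0), (128, 4), (36, 7), (6, 15), (59, 16)]),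
      (8, [(296, 0), (840, 4), (55, 9), (8, 10), (369, 16)]),
      (3, [(138, 0), (162, 4), (48, 7), (11, 15), (82, 16)])],
    ![ (4, [(3, 0), (7, 4), (1, 5), (3, 17)]), (9, [(9, 0), (1, 2), (15, 4), (2, 6), (12, 17)]),
      (1, [(1, 17)]), (8, [(1, 16), (1, 17)]), (7, [(5, 4), (4, 7), (2, 17), (2, 18), (1, 19)]),
      (1, [(1, 18)]), (1, [(1, 19)]), (1, [(1, 3), (2, 4)]),
      (12, [(191, 0), (363, 4), (162, 7), (105, 17), (31, 18)]),
      (8, [(40, 2), (240, 4), (40, 7), (11, 16), (43, 17)]),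
      (2, [(16, 2), (108, 4), (28, 7), (5, 16), (19, 17)]),
      (2, [(16, 2), (116, 4), (36, 7), (5, 16), (23, 17)]),
      (4, [(107, 0), (279, 4), (162, 7), (89, 17), (27, 18)]),
      (8, [(344, 3), (816, 4), (64, 7), (35, 16), (91, 17)]),
      (11, [(225, 0), (725, 4), (486, 7), (243, 17), (103, 19)]),
      (1, [(18, 0), (46, 4), (26, 7), (13, 17), (6, 18)]),
      (4, [(132, 3), (328, 4), (44, 7), (9, 16), (37, 17)]),
      (3, [(5, 2), (96, 4), (18, 5), (4, 6), (36, 17)]),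
      (4, [(32, 4), (16, 7), (13, 16), (5, 17), (28, 18)]),
      (4, [(24, 4), (16, 7), (5, 16), (9, 17), (16, 18)]),
      (2, [(136, 3), (354, 4), (7, 13), (12, 16), (55, 17)]),
      (4, [(115, 0), (219, 4), (29, 5), (107, 17), (4, 19)]),
      (11, [(556, 0), (1236, 4), (25, 13), (564, 17), (10, 24)]),
      (2, [(128, 4), (10, 13), (57, 16), (29, 17), (80, 19)]),
      (11, [(734, 4), (190, 5), (302, 17), (314, 18), (5, 19)]),
      (7, [(306, 4), (284, 7), (142, 17), (156, 18), (71, 19)]),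
      (7, [(180, 4), (158, 7), (86, 17), (149, 18), (29, 19)]),
      (2, [(24, 4), (16, 7), (3, 16), (9, 17), (36, 18)])],
    ![ (1, [(2, 3), (5, 4), (2, 7)]), (8, [(8, 0), (3, 2), (42, 4), (30, 7), (3, 19)]),
      (1, [(1, 2), (6, 4), (2, 7)]), (1, [(1, 3), (2, 4)]), (1, [(1, 4), (1, 5)]),
      (1, [(1, 5), (1, 6)]), (1, [(1, 6), (2, 7)]), (1, [(1, 7)]),
      (4, [(100, 4), (43, 5), (42, 7), (6, 17), (3, 18)]),
      (4, [(40, 4), (9, 5), (14, 6), (50, 7), (9, 18)]),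
      (27, [(386, 4), (34, 5), (782, 7), (117, 19), (8, 24)]),
      (27, [(286, 4), (14, 5), (538, 7), (99, 19), (16, 24)]),
      (2, [(24, 4), (2, 5), (2, 16), (1, 24), (3, 25)]),
      (14, [(360, 4), (209, 5), (154, 7), (49, 18), (4, 25)]),
      (7, [(116, 4), (15, 5), (238, 7), (28, 19), (10, 25)]),
      (1, [(9, 3), (24, 4), (15, 7), (1, 24)]), (1, [(1, 24)]), (1, [(1, 25)]), (1, [(1, 26)]),
      (1, [(1, 27)]), (1, [(105, 3), (280, 4), (105, 7), (1, 8)]),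
      (3, [(70, 0), (192, 4), (102, 7), (8, 18), (3, 24)]),
      (1, [(146, 3), (374, 4), (146, 7), (1, 10)]), (1, [(174, 3), (442, 4), (174, 7), (1, 11)]),
      (1, [(6, 2), (98, 4), (78, 5), (1, 6), (26, 7)]), (1, [(7, 0), (71, 4), (73, 5), (2, 6)]),
      (1, [(1, 2), (28, 4), (37, 5), (12, 6), (1, 27)]),
      (1, [(1, 0), (1, 2), (29, 4), (31, 5), (7, 6)])]]

theorem cert_spec (i : Fin 7) (j : Fin 28) :
    0 < (cert i j).1 ∧
      ((cert i j).1 : ℤ) • (reflection *ᵥ (companionPow i.succ *ᵥ rays j)) =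
        (-1 : ℤ) ^ (i : ℕ) • ((cert i j).2.map fun c => (c.1 : ℤ) • rays c.2).sum := by
  revert i j
  decide +kernel

/-- Two functionals that are nonnegative on the cone spanned by `rays`. -/
def functionals : Fin 2 → Fin 5 → ℤ := ![![1, 1, 1, 1, 1], ![-5, -3, -1, 1, 3]]

theorem functionals_nonneg (w : Fin 2) (j : Fin 28) : 0 ≤ functionals w ⬝ᵥ rays j := by
  revert w j
  decide +kernel

theorem functionals_separate (i : Fin 8) (e : Fin 2) (h : ¬(i = 0 ∧ e = 0)) :
    (∃ w j, functionals w ⬝ᵥ ((companionPow i * reflection ^ (e : ℕ)) *ᵥ rays j) < 0) ∧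
      ∃ w j, 0 < functionals w ⬝ᵥ ((companionPow i * reflection ^ (e : ℕ)) *ᵥ rays j) := by
  revert i e
  decide +kernel

theorem companionPow_succ (i : Fin 7) :
    companionPow i.succ = companionPow i.castSucc * companionPow 1 := by
  revert i
  decide +kernel

theorem companionPow_eq_pow (i : Fin 8) : companionPow i = companionPow 1 ^ (i : ℕ) := by
  induction i using Fin.induction with
  | zero => decide +kernel
  | succ i ih => rw [companionPow_succ, ih, Fin.val_succ, pow_succ, Fin.val_castSucc]

/-- The pairing of a rational functional with an integral vector. -/
def pairing (x : Fin 5 → ℚ) : (Fin 5 → ℤ) →+ ℚ where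
  toFun v := x ⬝ᵥ (Int.castRingHom ℚ ∘ v)
  map_zero' := by simp [dotProduct]
  map_add' v w := by simp [dotProduct, mul_add, Finset.sum_add_distrib]

theorem pairing_vecMul (x : Fin 5 → ℚ) (N : Matrix (Fin 5) (Fin 5) ℤ) (v : Fin 5 → ℤ) :
    pairing (x ᵥ* N.map (Int.castRingHom ℚ)) v = pairing x (N *ᵥ v) := by
  change x ᵥ* N.map (Int.castRingHom ℚ) ⬝ᵥ (Int.castRingHom ℚ ∘ v) =
    x ⬝ᵥ (Int.castRingHom ℚ ∘ (N *ᵥ v))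
  rw [← dotProduct_mulVec]
  congr 1
  ext i
  exact (RingHom.map_mulVec _ N v i).symm

theorem pairing_neg (x : Fin 5 → ℚ) (v : Fin 5 → ℤ) : pairing (-x) v = -pairing x v :=
  neg_dotProduct x (Int.castRingHom ℚ ∘ v)

theorem pairing_intCast (x v : Fin 5 → ℤ) :
    pairing (Int.castRingHom ℚ ∘ x) v = ((x ⬝ᵥ v : ℤ) : ℚ) :=
  (RingHom.map_dotProduct (Int.castRingHom ℚ) x v).symm

/-- The rational cone dual to the cone spanned by `rays`. -/
def dualCone : Set (Fin 5 → ℚ) := {x | ∀ j, 0 ≤ pairing x (rays j)}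

/-- The matrices whose right action maps `dualCone` into itself or into its negative. -/
def coneStabilizer : Submonoid (GL (Fin 5) ℚ) where
  carrier := {M | (∀ x ∈ dualCone, x ᵥ* (M : Matrix (Fin 5) (Fin 5) ℚ) ∈ dualCone) ∨
    ∀ x ∈ dualCone, -(x ᵥ* (M : Matrix (Fin 5) (Fin 5) ℚ)) ∈ dualCone}
  one_mem' := Or.inl fun x hx => by simpa using hx
  mul_mem' := by
    rintro M N (hM | hM) (hN | hN)
    · exact Or.inl fun x hx => by simpa using hN _ (hM x hx)
    · exact Or.inr fun x hx => by simpa using hN _ (hM x hx)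
    · exact Or.inr fun x hx => by simpa [neg_vecMul] using hN _ (hM x hx)
    · exact Or.inl fun x hx => by simpa [neg_vecMul] using hN _ (hM x hx)

theorem mem_coneStabilizer {M : GL (Fin 5) ℚ} (i : Fin 7)
    (hM : (M : Matrix (Fin 5) (Fin 5) ℚ) =
      (reflection * companionPow i.succ).map (Int.castRingHom ℚ)) : M ∈ coneStabilizer := by
  have key : ∀ x ∈ dualCone, ∀ j,
      0 ≤ (-1 : ℚ) ^ (i : ℕ) * pairing (x ᵥ* (M : Matrix (Fin 5) (Fin 5) ℚ)) (rays j) := by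
    intro x hx j
    obtain ⟨hd, h⟩ := cert_spec i j
    replace h := congrArg (pairing x) h
    rw [mulVec_mulVec, map_zsmul, map_zsmul, map_list_sum, List.map_map, ← pairing_vecMul, ← hM,
      zsmul_eq_mul, zsmul_eq_mul] at h
    push_cast at h
    have hsum : 0 ≤ (List.map (pairing x ∘ fun c : ℕ × Fin 28 => (c.1 : ℤ) • rays c.2)
        (cert i j).2).sum := by
      refine List.sum_nonneg fun a ha => ?_
      obtain ⟨c, -, rfl⟩ := List.mem_map.mp ha
      rw [Function.comp_apply, map_zsmul, zsmul_eq_mul]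
      exact mul_nonneg (by positivity) (hx c.2)
    have hd' : (0 : ℚ) < (cert i j).1 := by exact_mod_cast hd
    refine nonneg_of_mul_nonneg_right (a := ((cert i j).1 : ℚ)) ?_ hd'
    rw [mul_left_comm, h, ← mul_assoc, ← mul_pow]
    simpa using hsum
  rcases neg_one_pow_eq_or ℚ (i : ℕ) with h | h
  · exact Or.inl fun x hx j => by simpa [h] using key x hx j
  · exact Or.inr fun x hx j => by simpa [h, pairing_neg] using key x hx j

theorem eq_zero_of_mem_coneStabilizer {M : GL (Fin 5) ℚ} (hMS : M ∈ coneStabilizer) (i : Fin 8)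
    (e : Fin 2) (hM : (M : Matrix (Fin 5) (Fin 5) ℚ) =
      (companionPow i * reflection ^ (e : ℕ)).map (Int.castRingHom ℚ)) : i = 0 ∧ e = 0 := by
  by_contra hne
  obtain ⟨⟨w, j, hneg⟩, w', j', hpos⟩ := functionals_separate i e hne
  have hmem (w : Fin 2) : (Int.castRingHom ℚ ∘ functionals w) ∈ dualCone := fun j => by
    rw [pairing_intCast]
    exact_mod_cast functionals_nonneg w j
  rcases hMS with h | h
  · have := h _ (hmem w) j
    rw [hM, pairing_vecMul, pairing_intCast] at this
    exact absurd hneg (not_lt.mpr (by exact_mod_cast this))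
  · have := h _ (hmem w') j'
    rw [hM, pairing_neg, pairing_vecMul, pairing_intCast] at this
    exact absurd hpos (not_lt.mpr (by exact_mod_cast neg_nonneg.mp this))

theorem companionMatrix_companionPow :
    companionMatrix ((X + 1) * (X ^ 4 + 1)) = (companionPow 1).map (Int.castRingHom ℚ) := by
  have h : ((X + 1) * (X ^ 4 + 1) : ℚ[X]) = X ^ 5 + X ^ 4 + X + 1 := by ring
  rw [h]
  ext i j
  fin_cases i <;> fin_cases j <;>
    simp [companionMatrix, companionPow, coeff_X, coeff_one, coeff_X_pow]

theorem reflection_mul_companionMatrix :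
    reflection.map (Int.castRingHom ℚ) * companionMatrix ((X - 1) ^ 5) =
      companionMatrix ((X + 1) * (X ^ 4 + 1)) := by
  have h : ((X - 1) ^ 5 : ℚ[X]) =
      X ^ 5 - C 5 * X ^ 4 + C 10 * X ^ 3 - C 10 * X ^ 2 + C 5 * X - 1 := by
    simp only [map_ofNat]
    ring
  rw [companionMatrix_companionPow, h]
  ext i j
  fin_cases i <;> fin_cases j <;>
    norm_num [Matrix.mul_apply, Fin.sum_univ_succ, companionMatrix, companionPow, reflection,
      coeff_X, coeff_one, coeff_X_pow, coeff_C_mul]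

end HypergeometricPingPong

open HypergeometricPingPong

/-- `Γ(f,g) = ⟨T⟩ ∗ ⟨B⟩` for `f = ((X - 1) ^ 5)`, `g = ((X + 1) * (X ^ 4 + 1))`. -/
theorem hypergeometric_free_product_case6 (A B T : GL (Fin 5) ℚ)
    (hA : (↑A : Matrix (Fin 5) (Fin 5) ℚ) = companionMatrix ((X - 1) ^ 5))
    (hB : (↑B : Matrix (Fin 5) (Fin 5) ℚ) = companionMatrix ((X + 1) * (X ^ 4 + 1)))
    (hT : T = B * A⁻¹) :
    T ^ 2 = 1 ∧ T ≠ 1 ∧ orderOf B = 8 ∧ (∀ i : ℤ, B ^ i ≠ -1) ∧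
    ∃ φ : Monoid.Coprod (Multiplicative (ZMod 2)) (Multiplicative (ZMod 8)) →* GL (Fin 5) ℚ,
      φ (Monoid.Coprod.inl (Multiplicative.ofAdd (1 : ZMod 2))) = T ∧
      φ (Monoid.Coprod.inr (Multiplicative.ofAdd (1 : ZMod 8))) = B ∧
      Function.Injective φ ∧
      φ.range = Subgroup.closure {A, B} := by
  have hBr : (B : Matrix (Fin 5) (Fin 5) ℚ) = (companionPow 1).map (Int.castRingHom ℚ) := by
    rw [hB, companionMatrix_companionPow]
  have hTr : (T : Matrix (Fin 5) (Fin 5) ℚ) = reflection.map (Int.castRingHom ℚ) := by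
    have : ((T * A : GL (Fin 5) ℚ) : Matrix (Fin 5) (Fin 5) ℚ) =
        reflection.map (Int.castRingHom ℚ) * (A : Matrix (Fin 5) (Fin 5) ℚ) := by
      rw [hT, inv_mul_cancel_right, hA, reflection_mul_companionMatrix, hB]
    rw [Units.val_mul] at this
    exact A.isUnit.mul_right_cancel this
  have hBpow (i : Fin 8) : ((B ^ (i : ℕ) : GL (Fin 5) ℚ) : Matrix (Fin 5) (Fin 5) ℚ) =
      (companionPow i).map (Int.castRingHom ℚ) := by
    rw [Units.val_pow_eq_pow_val, hBr, companionPow_eq_pow i, Matrix.map_pow]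
  have hcast : Function.Injective
      fun N : Matrix (Fin 5) (Fin 5) ℤ => N.map (Int.castRingHom ℚ) :=
    Matrix.map_injective Int.cast_injective
  have hone : (1 : Matrix (Fin 5) (Fin 5) ℚ) =
      (1 : Matrix (Fin 5) (Fin 5) ℤ).map (Int.castRingHom ℚ) := by simp
  have hT2 : T ^ 2 = 1 := by
    ext1
    rw [Units.val_pow_eq_pow_val, hTr, ← Matrix.map_pow, Units.val_one, hone]
    congr 1
    decide +kernel
  have hB8 : B ^ 8 = 1 := by
    ext1
    rw [Units.val_pow_eq_pow_val, hBr, ← Matrix.map_pow, Units.val_one, hone, pow_succ,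
      show companionPow 1 ^ 7 = companionPow 7 from (companionPow_eq_pow 7).symm]
    congr 1
    decide +kernel
  have hT1 : T ≠ 1 := fun h => by
    have := congrArg Units.val h
    rw [hTr, Units.val_one, hone] at this
    exact absurd (hcast this) (by decide +kernel)
  have hB4 : B ^ 4 ≠ 1 := fun h => by
    have := (hBpow 4).symm.trans (congrArg Units.val h)
    rw [Units.val_one, hone] at this
    exact absurd (hcast this) (by decide +kernel)
  have hord : orderOf B = 8 := orderOf_eq_prime_pow (p := 2) (n := 2) hB4 hB8
  refine ⟨hT2, hT1, hord, fun i hi => ?_, ?_⟩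
  · rw [← zpow_mod_orderOf, hord] at hi
    obtain ⟨k, hk⟩ := Int.eq_ofNat_of_zero_le (Int.emod_nonneg i (by norm_num : (8 : ℤ) ≠ 0))
    have hk8 : k < 8 := by omega
    rw [Nat.cast_ofNat, hk, zpow_natCast] at hi
    have := congrArg Units.val hi
    rw [hBpow ⟨k, hk8⟩, Units.val_neg, Units.val_one,
      show (-1 : Matrix (Fin 5) (Fin 5) ℚ) =
        (-1 : Matrix (Fin 5) (Fin 5) ℤ).map (Int.castRingHom ℚ) by
          rw [Matrix.map_neg _ (map_neg _), ← hone]] at this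
    have hne : ∀ j : Fin 8, companionPow j ≠ -1 := by decide +kernel
    exact hne _ (hcast this)
  · have hinl (k : ℕ) : zmodPowersHom 2 T hT2 (Multiplicative.ofAdd (k : ZMod 2)) = T ^ k :=
      zmodPowersHom_ofAdd_natCast 2 T hT2 k
    have hinr (k : ℕ) : zmodPowersHom 8 B hB8 (Multiplicative.ofAdd (k : ZMod 8)) = B ^ k :=
      zmodPowersHom_ofAdd_natCast 8 B hB8 k
    have hinl1 := hinl 1
    have hinr1 := hinr 1
    rw [Nat.cast_one, pow_one] at hinl1 hinr1
    refine ⟨Monoid.Coprod.lift (zmodPowersHom 2 T hT2) (zmodPowersHom 8 B hB8),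
      by simpa using hinl1, by simpa using hinr1, ?_, ?_⟩
    · refine Monoid.Coprod.injective_of_submonoid _ coneStabilizer (by decide) ?_ ?_
      · intro e he i hi
        obtain rfl : e = Multiplicative.ofAdd (1 : ZMod 2) := by revert e; decide
        obtain ⟨i, rfl⟩ := exists_ofAdd_natCast_eq i
        obtain ⟨j, rfl⟩ := Fin.exists_succ_eq.mpr (show i ≠ 0 by rintro rfl; exact hi (by simp))
        rw [map_mul, Monoid.Coprod.lift_apply_inl, Monoid.Coprod.lift_apply_inr, hinl1, hinr]
        refine mem_coneStabilizer j ?_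
        rw [Units.val_mul, hBpow, hTr, Matrix.map_mul]
      · intro i e hmem
        obtain ⟨i, rfl⟩ := exists_ofAdd_natCast_eq i
        obtain ⟨e, rfl⟩ := exists_ofAdd_natCast_eq e
        rw [map_mul, Monoid.Coprod.lift_apply_inl, Monoid.Coprod.lift_apply_inr, hinl,
          hinr] at hmem
        obtain ⟨rfl, rfl⟩ := eq_zero_of_mem_coneStabilizer hmem i e (by
          rw [Units.val_mul, hBpow, Units.val_pow_eq_pow_val, hTr, Matrix.map_mul, Matrix.map_pow])
        simp
    · rw [Monoid.Coprod.range_lift]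
      apply le_antisymm
      · have hAmem : A ∈ Subgroup.closure {A, B} := Subgroup.subset_closure (by simp)
        have hBmem : B ∈ Subgroup.closure {A, B} := Subgroup.subset_closure (by simp)
        have hTmem : T ∈ Subgroup.closure {A, B} := hT ▸ mul_mem hBmem (inv_mem hAmem)
        refine sup_le ?_ ?_
        · rintro _ ⟨e, rfl⟩
          obtain ⟨k, rfl⟩ := exists_ofAdd_natCast_eq e
          rw [hinl]
          exact pow_mem hTmem _
        · rintro _ ⟨i, rfl⟩
          obtain ⟨k, rfl⟩ := exists_ofAdd_natCast_eq i
          rw [hinr]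
          exact pow_mem hBmem _
      · have hTmem : T ∈ (zmodPowersHom 2 T hT2).range ⊔ (zmodPowersHom 8 B hB8).range :=
          Subgroup.mem_sup_left ⟨_, hinl1⟩
        have hBmem : B ∈ (zmodPowersHom 2 T hT2).range ⊔ (zmodPowersHom 8 B hB8).range :=
          Subgroup.mem_sup_right ⟨_, hinr1⟩
        have hAT : A = T⁻¹ * B := by rw [hT]; group
        rw [Subgroup.closure_le]
        rintro _ (rfl | rfl)
        · exact hAT ▸ mul_mem (inv_mem hTmem) hBmem
        · exact hBmem
end
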